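/- Every two-qubit Clifford unitary U admits a decomposition U = (A⊗B) · CZ^a · SWAP^b · (C⊗D) where A,B,C,D are single-qubit Clifford unitaries and a,b ∈ {0,1}; moreover the pair (a,b) is uniquely determined by U, yielding exactly four KAK-equivalence classes. -/

import Mathlib

open Kronecker

def pauli1 : Fin 4 → Matrix (Fin 2) (Fin 2) ℂ
  | 0 => 1
  | 1 => !![0, 1; 1, 0]
  | 2 => !![0, -Complex.I; Complex.I, 0]
  | 3 => !![1, 0; 0, -1]

/-- The single-qubit Pauli group (Paulis with phases `±1, ±i`). -/
def Pauli1Group : Set (Matrix (Fin 2) (Fin 2) ℂ) :=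
  {A | ∃ c : ℂ, (c = 1 ∨ c = -1 ∨ c = Complex.I ∨ c = -Complex.I) ∧
    ∃ k : Fin 4, A = c • pauli1 k}

/-- The two-qubit Pauli group. -/
def Pauli2Group : Set (Matrix (Fin 2 × Fin 2) (Fin 2 × Fin 2) ℂ) :=
  {A | ∃ c : ℂ, (c = 1 ∨ c = -1 ∨ c = Complex.I ∨ c = -Complex.I) ∧
    ∃ j k : Fin 4, A = c • (pauli1 j ⊗ₖ pauli1 k)}

/-- Single-qubit Clifford unitaries: unitaries normalizing the Pauli group. -/
def Clifford1 (A : Matrix (Fin 2) (Fin 2) ℂ) : Prop :=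
  A ∈ Matrix.unitaryGroup (Fin 2) ℂ ∧
  ∀ P ∈ Pauli1Group, A * P * star A ∈ Pauli1Group

/-- Two-qubit Clifford unitaries. -/
def Clifford2 (U : Matrix (Fin 2 × Fin 2) (Fin 2 × Fin 2) ℂ) : Prop :=
  U ∈ Matrix.unitaryGroup (Fin 2 × Fin 2) ℂ ∧
  ∀ P ∈ Pauli2Group, U * P * star U ∈ Pauli2Group

def CZgate : Matrix (Fin 2 × Fin 2) (Fin 2 × Fin 2) ℂ :=
  fun p q => if p = q then (if p.1 = 1 ∧ p.2 = 1 then -1 else 1) else 0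

def SWAPgate : Matrix (Fin 2 × Fin 2) (Fin 2 × Fin 2) ℂ :=
  fun p q => if p.1 = q.2 ∧ p.2 = q.1 then 1 else 0

/-- The commutation sign of two Pauli matrices. -/
def pauliSign (j k : Fin 4) : ℤ := if j = 0 ∨ k = 0 ∨ j = k then 1 else -1

/-- The phase appearing in the product of two Pauli matrices. -/
noncomputable def pauliPhase (j k : Fin 4) : ℂ :=
  if j = 0 ∨ k = 0 ∨ j = k then 1
  else if (j = 1 ∧ k = 2) ∨ (j = 2 ∧ k = 3) ∨ (j = 3 ∧ k = 1) then Complex.I else -Complex.I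

theorem pauli1_mul (j k : Fin 4) :
    pauli1 j * pauli1 k = pauliPhase j k • pauli1 (j ^^^ k) := by
  fin_cases j <;> fin_cases k <;> ext a b <;> fin_cases a <;> fin_cases b <;>
    simp [pauli1, pauliPhase]

theorem pauli1_mul_comm (j k : Fin 4) :
    pauli1 j * pauli1 k = (pauliSign j k : ℂ) • (pauli1 k * pauli1 j) := by
  fin_cases j <;> fin_cases k <;> ext a b <;> fin_cases a <;> fin_cases b <;>
    simp [pauli1, pauliSign]

theorem pauli1_mul_self (j : Fin 4) : pauli1 j * pauli1 j = 1 := by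
  fin_cases j <;> ext a b <;> fin_cases a <;> fin_cases b <;> simp [pauli1]

theorem star_pauli1 (j : Fin 4) : star (pauli1 j) = pauli1 j := by
  fin_cases j <;> ext a b <;> fin_cases a <;> fin_cases b <;>
    simp [pauli1]

theorem star_kronecker (A B : Matrix (Fin 2) (Fin 2) ℂ) :
    star (A ⊗ₖ B) = star A ⊗ₖ star B :=
  Matrix.conjTranspose_kronecker A B

theorem CZgate_mul_self : CZgate * CZgate = 1 := by
  ext ⟨a, b⟩ ⟨c, d⟩
  fin_cases a <;> fin_cases b <;> fin_cases c <;> fin_cases d <;>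
    simp [CZgate, Matrix.mul_apply]

theorem star_CZgate : star CZgate = CZgate := by
  ext ⟨a, b⟩ ⟨c, d⟩
  fin_cases a <;> fin_cases b <;> fin_cases c <;> fin_cases d <;>
    simp [CZgate]

theorem SWAPgate_mul_self : SWAPgate * SWAPgate = 1 := by
  ext ⟨a, b⟩ ⟨c, d⟩
  fin_cases a <;> fin_cases b <;> fin_cases c <;> fin_cases d <;>
    simp [SWAPgate, Matrix.mul_apply, Fintype.sum_prod_type]

theorem star_SWAPgate : star SWAPgate = SWAPgate := by
  ext ⟨a, b⟩ ⟨c, d⟩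
  fin_cases a <;> fin_cases b <;> fin_cases c <;> fin_cases d <;>
    simp [SWAPgate]

theorem SWAPgate_mul_kronecker (A B : Matrix (Fin 2) (Fin 2) ℂ) :
    SWAPgate * (A ⊗ₖ B) = (B ⊗ₖ A) * SWAPgate := by
  ext ⟨a, b⟩ ⟨c, d⟩
  fin_cases a <;> fin_cases b <;> fin_cases c <;> fin_cases d <;>
    simp [SWAPgate, Matrix.mul_apply, Fintype.sum_prod_type] <;> ring

theorem SWAPgate_mul_CZgate : SWAPgate * CZgate = CZgate * SWAPgate := by
  ext ⟨a, b⟩ ⟨c, d⟩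
  fin_cases a <;> fin_cases b <;> fin_cases c <;> fin_cases d <;>
    simp [SWAPgate, CZgate, Matrix.mul_apply, Fintype.sum_prod_type]

theorem CZgate_mul_pauli1_kronecker_one (j : Fin 4) :
    CZgate * (pauli1 j ⊗ₖ 1) =
      (pauli1 j ⊗ₖ pauli1 (if j = 1 ∨ j = 2 then 3 else 0)) * CZgate := by
  ext ⟨a, b⟩ ⟨c, d⟩
  fin_cases j <;> fin_cases a <;> fin_cases b <;> fin_cases c <;> fin_cases d <;>
    simp [CZgate, pauli1, Matrix.mul_apply, Fintype.sum_prod_type, Matrix.one_apply]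

theorem CZgate_mul_one_kronecker_pauli1 (k : Fin 4) :
    CZgate * (1 ⊗ₖ pauli1 k) =
      (pauli1 (if k = 1 ∨ k = 2 then 3 else 0) ⊗ₖ pauli1 k) * CZgate := by
  calc CZgate * (1 ⊗ₖ pauli1 k)
      = SWAPgate * (CZgate * (pauli1 k ⊗ₖ 1)) * SWAPgate := by
        rw [← mul_assoc, SWAPgate_mul_CZgate, mul_assoc, mul_assoc CZgate, ← SWAPgate_mul_kronecker,
          ← mul_assoc SWAPgate, SWAPgate_mul_self, one_mul]
    _ = _ := by
        rw [CZgate_mul_pauli1_kronecker_one, ← mul_assoc, SWAPgate_mul_kronecker, mul_assoc,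
          mul_assoc, ← SWAPgate_mul_CZgate, ← mul_assoc SWAPgate, SWAPgate_mul_self, one_mul]

/-- A matrix commuting with `X ⊗ 1` and `Z ⊗ 1` acts on the second factor only. -/
theorem exists_eq_one_kronecker (V : Matrix (Fin 2 × Fin 2) (Fin 2 × Fin 2) ℂ)
    (hX : V * (pauli1 1 ⊗ₖ 1) = (pauli1 1 ⊗ₖ 1) * V)
    (hZ : V * (pauli1 3 ⊗ₖ 1) = (pauli1 3 ⊗ₖ 1) * V) :
    ∃ B : Matrix (Fin 2) (Fin 2) ℂ, V = 1 ⊗ₖ B := by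
  have h1 : ∀ i j, V (0, i) (1, j) = 0 := fun i j => by
    have h := congrFun (congrFun hZ (0, i)) (1, j)
    fin_cases i <;> fin_cases j <;>
      simp [pauli1, Matrix.mul_apply, Fintype.sum_prod_type, Matrix.one_apply] at h ⊢ <;>
      linear_combination (-1 / 2) * h
  have h2 : ∀ i j, V (1, i) (0, j) = 0 := fun i j => by
    have h := congrFun (congrFun hZ (1, i)) (0, j)
    fin_cases i <;> fin_cases j <;>
      simp [pauli1, Matrix.mul_apply, Fintype.sum_prod_type, Matrix.one_apply] at h ⊢ <;>
      linear_combination (1 / 2) * h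
  have h3 : ∀ i j, V (1, i) (1, j) = V (0, i) (0, j) := fun i j => by
    have h := congrFun (congrFun hX (0, i)) (1, j)
    fin_cases i <;> fin_cases j <;>
      simp [pauli1, Matrix.mul_apply, Fintype.sum_prod_type, Matrix.one_apply] at h ⊢ <;>
      exact h.symm
  refine ⟨Matrix.of fun i j => V (0, i) (0, j), ?_⟩
  ext ⟨a, b⟩ ⟨c, d⟩
  fin_cases a <;> fin_cases c <;> simp [Matrix.kroneckerMap_apply, h1, h2, h3]

theorem pauli1_mem_Pauli1Group (k : Fin 4) : pauli1 k ∈ Pauli1Group :=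
  ⟨1, Or.inl rfl, k, (one_smul _ _).symm⟩

theorem smul_mem_Pauli1Group {c : ℂ} (hc : c = 1 ∨ c = -1 ∨ c = Complex.I ∨ c = -Complex.I)
    {P : Matrix (Fin 2) (Fin 2) ℂ} (hP : P ∈ Pauli1Group) : c • P ∈ Pauli1Group := by
  obtain ⟨d, hd, k, rfl⟩ := hP
  refine ⟨c * d, ?_, k, smul_smul _ _ _⟩
  rcases hc with rfl | rfl | rfl | rfl <;> rcases hd with rfl | rfl | rfl | rfl <;> simp

theorem mul_mem_Pauli1Group {P Q : Matrix (Fin 2) (Fin 2) ℂ} (hP : P ∈ Pauli1Group)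
    (hQ : Q ∈ Pauli1Group) : P * Q ∈ Pauli1Group := by
  obtain ⟨c, hc, j, rfl⟩ := hP
  obtain ⟨d, hd, k, rfl⟩ := hQ
  rw [Matrix.smul_mul, Matrix.mul_smul, pauli1_mul]
  refine smul_mem_Pauli1Group hc (smul_mem_Pauli1Group hd
    (smul_mem_Pauli1Group ?_ (pauli1_mem_Pauli1Group _)))
  unfold pauliPhase
  split_ifs <;> simp

theorem kronecker_mem_Pauli2Group {P Q : Matrix (Fin 2) (Fin 2) ℂ} (hP : P ∈ Pauli1Group)
    (hQ : Q ∈ Pauli1Group) : P ⊗ₖ Q ∈ Pauli2Group := by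
  obtain ⟨c, hc, j, rfl⟩ := hP
  obtain ⟨d, hd, k, rfl⟩ := hQ
  refine ⟨c * d, ?_, j, k, ?_⟩
  · rcases hc with rfl | rfl | rfl | rfl <;> rcases hd with rfl | rfl | rfl | rfl <;> simp
  · rw [Matrix.smul_kronecker, Matrix.kronecker_smul, smul_smul]

theorem exists_kronecker_of_mem_Pauli2Group {R : Matrix (Fin 2 × Fin 2) (Fin 2 × Fin 2) ℂ}
    (hR : R ∈ Pauli2Group) : ∃ P ∈ Pauli1Group, ∃ Q ∈ Pauli1Group, R = P ⊗ₖ Q := by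
  obtain ⟨c, hc, j, k, rfl⟩ := hR
  exact ⟨c • pauli1 j, ⟨c, hc, j, rfl⟩, pauli1 k, pauli1_mem_Pauli1Group k,
    (Matrix.smul_kronecker _ _ _).symm⟩

theorem finite_Pauli1Group : Pauli1Group.Finite := by
  have : Pauli1Group = Set.image2 (fun (c : ℂ) k => c • pauli1 k)
      {1, -1, Complex.I, -Complex.I} Set.univ := by
    ext A
    simp [Pauli1Group, eq_comm]
  rw [this]
  exact Set.Finite.image2 _ (Set.toFinite _) (Set.toFinite _)

namespace Clifford1

variable {A B : Matrix (Fin 2) (Fin 2) ℂ}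

theorem star_mul_self (hA : Clifford1 A) : star A * A = 1 := Matrix.mem_unitaryGroup_iff'.1 hA.1

theorem mul_star_self (hA : Clifford1 A) : A * star A = 1 := Matrix.mem_unitaryGroup_iff.1 hA.1

theorem one : Clifford1 1 := ⟨one_mem _, fun P hP => by simpa using hP⟩

theorem mul (hA : Clifford1 A) (hB : Clifford1 B) : Clifford1 (A * B) :=
  ⟨mul_mem hA.1 hB.1, fun P hP => by
    have := hA.2 _ (hB.2 P hP)
    simpa only [star_mul, mul_assoc] using this⟩

protected theorem star (hA : Clifford1 A) : Clifford1 (star A) := by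
  refine ⟨Unitary.star_mem hA.1, fun P hP => ?_⟩
  have hinj : Set.InjOn (fun P => A * P * star A) Pauli1Group := fun P _ Q _ h => by
    have h' := congrArg (fun M => star A * M * A) h
    simpa [mul_assoc, hA.star_mul_self, ← mul_assoc (star A) A] using h'
  obtain ⟨Q, hQ, rfl⟩ := ((finite_Pauli1Group.injOn_iff_bijOn_of_mapsTo
    fun P hP => hA.2 P hP).1 hinj).surjOn hP
  simpa [mul_assoc, hA.star_mul_self, ← mul_assoc (star A) A] using hQ

theorem of_conj_mem (hA : A ∈ Matrix.unitaryGroup (Fin 2) ℂ)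
    (hX : A * pauli1 1 * star A ∈ Pauli1Group) (hZ : A * pauli1 3 * star A ∈ Pauli1Group) :
    Clifford1 A := by
  have h1 := Matrix.mem_unitaryGroup_iff.1 hA
  have h2 := Matrix.mem_unitaryGroup_iff'.1 hA
  refine ⟨hA, ?_⟩
  rintro _ ⟨c, hc, k, rfl⟩
  rw [Matrix.mul_smul, Matrix.smul_mul]
  refine smul_mem_Pauli1Group hc ?_
  have hY : pauli1 2 = Complex.I • (pauli1 1 * pauli1 3) := by
    rw [pauli1_mul]
    simp [pauliPhase, smul_smul]
  fin_cases k
  · simpa [pauli1, h1] using pauli1_mem_Pauli1Group 0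
  · exact hX
  · have := smul_mem_Pauli1Group (c := Complex.I) (by simp) (mul_mem_Pauli1Group hX hZ)
    simp only [hY, Fin.reduceFinMk]
    convert this using 1
    rw [Matrix.mul_smul, Matrix.smul_mul]
    congr 1
    simp only [mul_assoc, ← mul_assoc (star A) A, h2, one_mul]
  · exact hZ

end Clifford1

theorem eq_one_of_commute (M : Matrix (Fin 2) (Fin 2) ℂ) (hX : M * pauli1 1 = pauli1 1 * M)
    (hZ : M * pauli1 3 = pauli1 3 * M) (h : M 0 0 = 1) : M = 1 := by
  have h1 := congrFun (congrFun hX 0) 1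
  have h2 := congrFun (congrFun hZ 0) 1
  have h3 := congrFun (congrFun hZ 1) 0
  simp [pauli1, Matrix.mul_apply] at h1 h2 h3
  ext i j
  fin_cases i <;> fin_cases j <;> simp
  · exact h
  · linear_combination (-1 / 2) * h2
  · linear_combination (1 / 2) * h3
  · rw [← h1, h]

open scoped Matrix in
theorem exists_unit_eigenvector (j : Fin 4) (hj : j ≠ 0) (t : ℂ) (ht : t = 1 ∨ t = -1) :
    ∃ v : Fin 2 → ℂ, (t • pauli1 j) *ᵥ v = v ∧ star (v 0) * v 0 + star (v 1) * v 1 = 1 := by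
  have hr : ((√2 : ℝ) : ℂ) ^ 2 = 2 := by
    rw [← Complex.ofReal_pow]; norm_num
  have h0 : ((√2 : ℝ) : ℂ) ≠ 0 := fun h => by simp [h] at hr
  have ht2 : t * t = 1 := by rcases ht with rfl | rfl <;> simp
  have hts : (starRingEnd ℂ) t = t := by rcases ht with rfl | rfl <;> simp
  fin_cases j
  · exact absurd rfl hj
  · refine ⟨![1 / (√2 : ℝ), t / (√2 : ℝ)], ?_, ?_⟩
    · ext i
      fin_cases i <;> simp [pauli1, Matrix.mulVec, dotProduct] <;> field_simp
      linear_combination ht2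
    · simp [hts]
      field_simp
      linear_combination ht2 - hr
  · refine ⟨![1 / (√2 : ℝ), Complex.I * t / (√2 : ℝ)], ?_, ?_⟩
    · ext i
      fin_cases i <;> simp [pauli1, Matrix.mulVec, dotProduct] <;> field_simp
      linear_combination ht2 - t * t * Complex.I_sq
    · simp [hts]
      field_simp
      linear_combination ht2 - hr - t * t * Complex.I_sq
  · refine ⟨![(1 + t) / 2, (1 - t) / 2], ?_, ?_⟩
    · ext i
      fin_cases i <;> simp [pauli1, Matrix.mulVec, dotProduct] <;> linear_combination ht2 / 2
    · simp [hts]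
      linear_combination ht2 / 2

open scoped Matrix in
/-- Any two signed anticommuting Pauli matrices are the images of `X` and `Z` under a single-qubit
Clifford. -/
theorem exists_clifford1_conj {j k : Fin 4} (h : pauliSign j k = -1) {s t : ℂ}
    (hs : s = 1 ∨ s = -1) (ht : t = 1 ∨ t = -1) :
    ∃ A, Clifford1 A ∧ A * pauli1 1 * star A = s • pauli1 j ∧
      A * pauli1 3 * star A = t • pauli1 k := by
  have hk : k ≠ 0 := by rintro rfl; simp [pauliSign] at h
  obtain ⟨v, hv, hn⟩ := exists_unit_eigenvector k hk t ht
  set P := s • pauli1 j with hP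
  set Q := t • pauli1 k with hQ
  have hPs : star P = P := by
    rcases hs with rfl | rfl <;> simp [hP, star_pauli1]
  have hQs : star Q = Q := by
    rcases ht with rfl | rfl <;> simp [hQ, star_pauli1]
  have hPP : P * P = 1 := by
    rcases hs with rfl | rfl <;> simp [hP, pauli1_mul_self]
  have hQP : Q * P = -(P * Q) := by
    rw [hP, hQ, Matrix.smul_mul, Matrix.smul_mul, Matrix.mul_smul, Matrix.mul_smul,
      pauli1_mul_comm j k, h, smul_comm]
    simp
  let A : Matrix (Fin 2) (Fin 2) ℂ := Matrix.of fun a b => if b = 0 then v a else (P *ᵥ v) a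
  have hcol : ∀ (M : Matrix (Fin 2) (Fin 2) ℂ) a, (M * A) a 0 = (M *ᵥ v) a ∧
      (M * A) a 1 = (M *ᵥ (P *ᵥ v)) a := fun M a => ⟨rfl, rfl⟩
  have hAX : A * pauli1 1 = P * A := by
    ext a b
    fin_cases b
    · simp only [Fin.zero_eta, (hcol P a).1]
      simp [A, pauli1, Matrix.mul_apply]
    · simp only [Fin.mk_one, (hcol P a).2, Matrix.mulVec_mulVec, hPP, Matrix.one_mulVec]
      simp [A, pauli1, Matrix.mul_apply]
  have hAZ : A * pauli1 3 = Q * A := by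
    ext a b
    fin_cases b
    · simp only [Fin.zero_eta, (hcol Q a).1, hv]
      simp [A, pauli1, Matrix.mul_apply]
    · simp only [Fin.mk_one, (hcol Q a).2, Matrix.mulVec_mulVec, hQP, Matrix.neg_mulVec,
        ← Matrix.mulVec_mulVec _ P Q, hv]
      simp [A, pauli1, Matrix.mul_apply]
  have hsX : star A * P = pauli1 1 * star A := by
    simpa [star_pauli1, hPs] using (congrArg star hAX).symm
  have hsZ : star A * Q = pauli1 3 * star A := by
    simpa [star_pauli1, hQs] using (congrArg star hAZ).symm
  have hAA : star A * A = 1 := by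
    refine eq_one_of_commute _ ?_ ?_ ?_
    · rw [mul_assoc, hAX, ← mul_assoc, hsX, mul_assoc]
    · rw [mul_assoc, hAZ, ← mul_assoc, hsZ, mul_assoc]
    · simpa [A, Matrix.mul_apply, Matrix.star_apply] using hn
  have hA : A ∈ Matrix.unitaryGroup (Fin 2) ℂ := Matrix.mem_unitaryGroup_iff'.2 hAA
  have hX : A * pauli1 1 * star A = P := by
    rw [hAX, mul_assoc, Matrix.mem_unitaryGroup_iff.1 hA, mul_one]
  have hZ : A * pauli1 3 * star A = Q := by
    rw [hAZ, mul_assoc, Matrix.mem_unitaryGroup_iff.1 hA, mul_one]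
  refine ⟨A, Clifford1.of_conj_mem hA ?_ ?_, hX, hZ⟩
  · rw [hX]
    exact smul_mem_Pauli1Group (by tauto) (pauli1_mem_Pauli1Group j)
  · rw [hZ]
    exact smul_mem_Pauli1Group (by tauto) (pauli1_mem_Pauli1Group k)

namespace Clifford2

variable {U V : Matrix (Fin 2 × Fin 2) (Fin 2 × Fin 2) ℂ}

theorem star_mul_self (hU : Clifford2 U) : star U * U = 1 := Matrix.mem_unitaryGroup_iff'.1 hU.1

theorem mul_star_self (hU : Clifford2 U) : U * star U = 1 := Matrix.mem_unitaryGroup_iff.1 hU.1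

theorem mul (hU : Clifford2 U) (hV : Clifford2 V) : Clifford2 (U * V) :=
  ⟨mul_mem hU.1 hV.1, fun P hP => by
    have := hU.2 _ (hV.2 P hP)
    simpa only [star_mul, mul_assoc] using this⟩

theorem one : Clifford2 1 := ⟨one_mem _, fun P hP => by simpa using hP⟩

theorem kronecker {A B : Matrix (Fin 2) (Fin 2) ℂ} (hA : Clifford1 A) (hB : Clifford1 B) :
    Clifford2 (A ⊗ₖ B) := by
  refine ⟨Matrix.kronecker_mem_unitary hA.1 hB.1, fun R hR => ?_⟩
  obtain ⟨P, hP, Q, hQ, rfl⟩ := exists_kronecker_of_mem_Pauli2Group hR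
  rw [star_kronecker, ← Matrix.mul_kronecker_mul, ← Matrix.mul_kronecker_mul]
  exact kronecker_mem_Pauli2Group (hA.2 P hP) (hB.2 Q hQ)

theorem swap : Clifford2 SWAPgate := by
  refine ⟨Matrix.mem_unitaryGroup_iff.2 (by rw [star_SWAPgate, SWAPgate_mul_self]), fun R hR => ?_⟩
  obtain ⟨P, hP, Q, hQ, rfl⟩ := exists_kronecker_of_mem_Pauli2Group hR
  rw [star_SWAPgate, SWAPgate_mul_kronecker, mul_assoc, SWAPgate_mul_self, mul_one]
  exact kronecker_mem_Pauli2Group hQ hP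

theorem cz : Clifford2 CZgate := by
  refine ⟨Matrix.mem_unitaryGroup_iff.2 (by rw [star_CZgate, CZgate_mul_self]), ?_⟩
  rintro _ ⟨c, hc, j, k, rfl⟩
  have h : pauli1 j ⊗ₖ pauli1 k = (pauli1 j ⊗ₖ 1) * (1 ⊗ₖ pauli1 k) := by
    rw [← Matrix.mul_kronecker_mul, mul_one, one_mul]
  rw [star_CZgate, ← Matrix.smul_kronecker, ← mul_one (c • pauli1 j), ← one_mul (pauli1 k),
    Matrix.mul_kronecker_mul, Matrix.smul_kronecker, Matrix.smul_mul, Matrix.mul_smul,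
    ← mul_assoc CZgate, CZgate_mul_pauli1_kronecker_one, mul_assoc (_ ⊗ₖ _),
    CZgate_mul_one_kronecker_pauli1, ← mul_assoc, ← Matrix.mul_kronecker_mul, Matrix.smul_mul,
    mul_assoc, CZgate_mul_self, mul_one, ← Matrix.smul_kronecker]
  exact kronecker_mem_Pauli2Group (smul_mem_Pauli1Group hc (mul_mem_Pauli1Group
    (pauli1_mem_Pauli1Group _) (pauli1_mem_Pauli1Group _)))
    (mul_mem_Pauli1Group (pauli1_mem_Pauli1Group _) (pauli1_mem_Pauli1Group _))

theorem ite_cz (a : Bool) : Clifford2 (if a then CZgate else 1) := by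
  cases a
  · exact one
  · exact cz

theorem conj_mul_conj (hU : Clifford2 U) (P Q : Matrix (Fin 2 × Fin 2) (Fin 2 × Fin 2) ℂ) :
    (U * P * star U) * (U * Q * star U) = U * (P * Q) * star U := by
  simp only [mul_assoc, ← mul_assoc (star U) U, hU.star_mul_self, one_mul]

end Clifford2

theorem pauli1_kronecker_mul_self (j k : Fin 4) :
    (pauli1 j ⊗ₖ pauli1 k) * (pauli1 j ⊗ₖ pauli1 k) = 1 := by
  rw [← Matrix.mul_kronecker_mul, pauli1_mul_self, pauli1_mul_self, Matrix.one_kronecker_one]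

theorem pauli1_zero : pauli1 0 = 1 := rfl

section Image

variable {U : Matrix (Fin 2 × Fin 2) (Fin 2 × Fin 2) ℂ}

theorem eq_one_or_neg_one_of_conj_eq (hU : Clifford2 U) {i j k : Fin 4} {c : ℂ}
    (h : U * (pauli1 i ⊗ₖ 1) * star U = c • (pauli1 j ⊗ₖ pauli1 k)) : c = 1 ∨ c = -1 := by
  have h1 := hU.conj_mul_conj (pauli1 i ⊗ₖ 1) (pauli1 i ⊗ₖ 1)
  rw [h, ← pauli1_zero, pauli1_kronecker_mul_self, mul_one, hU.mul_star_self, Matrix.smul_mul,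
    Matrix.mul_smul, pauli1_kronecker_mul_self, smul_smul] at h1
  have h2 := congrFun (congrFun h1 (0, 0)) (0, 0)
  exact mul_self_eq_one_iff.1 (by simpa using h2)

theorem exists_conj_eq (hU : Clifford2 U) (i : Fin 4) :
    ∃ (c : ℂ) (j k : Fin 4), U * (pauli1 i ⊗ₖ 1) * star U = c • (pauli1 j ⊗ₖ pauli1 k) := by
  obtain ⟨c, -, j, k, h⟩ := hU.2 _ (kronecker_mem_Pauli2Group (pauli1_mem_Pauli1Group i)
    (pauli1_mem_Pauli1Group 0))
  exact ⟨c, j, k, h⟩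

/-- The images of `X ⊗ 1` and `Z ⊗ 1` anticommute. -/
theorem pauliSign_mul_pauliSign (hU : Clifford2 U) {j k j' k' : Fin 4} {s t : ℂ}
    (hX : U * (pauli1 1 ⊗ₖ 1) * star U = s • (pauli1 j ⊗ₖ pauli1 k))
    (hZ : U * (pauli1 3 ⊗ₖ 1) * star U = t • (pauli1 j' ⊗ₖ pauli1 k')) :
    pauliSign j j' * pauliSign k k' = -1 := by
  set M := U * (pauli1 1 ⊗ₖ 1) * star U with hM
  set N := U * (pauli1 3 ⊗ₖ 1) * star U with hN
  have hanti : M * N = -(N * M) := by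
    rw [hM, hN, hU.conj_mul_conj, hU.conj_mul_conj, ← Matrix.mul_kronecker_mul,
      ← Matrix.mul_kronecker_mul, pauli1_mul_comm 1 3, Matrix.smul_kronecker]
    simp [pauliSign]
  have hcomm : M * N = ((pauliSign j j' * pauliSign k k' : ℤ) : ℂ) • (N * M) := by
    rw [hX, hZ]
    simp only [Matrix.smul_mul, Matrix.mul_smul, ← Matrix.mul_kronecker_mul]
    rw [pauli1_mul_comm j j', pauli1_mul_comm k k', Matrix.smul_kronecker, Matrix.kronecker_smul]
    simp only [smul_smul]
    congr 1
    push_cast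
    ring
  have hsq : (N * M) * (M * N) = 1 := by
    rw [mul_assoc, ← mul_assoc M, hM, hN, hU.conj_mul_conj, hU.conj_mul_conj, hU.conj_mul_conj,
      ← pauli1_zero, pauli1_kronecker_mul_self, one_mul, pauli1_kronecker_mul_self, mul_one,
      hU.mul_star_self]
  have h1 : pauliSign j j' * pauliSign k k' = 1 ∨ pauliSign j j' * pauliSign k k' = -1 := by
    unfold pauliSign
    split_ifs <;> simp
  refine h1.resolve_left fun h => ?_
  rw [h, Int.cast_one, one_smul] at hcomm
  have h2 : N * M = 0 := by
    ext a b
    exact self_eq_neg.1 (congrFun (congrFun (hcomm.symm.trans hanti) a) b)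
  rw [h2, zero_mul] at hsq
  exact zero_ne_one hsq

/-- Up to a Clifford on the first qubit, the image of `Z ⊗ 1` is supported on a single qubit. -/
theorem exists_conj_eq_local (hU : Clifford2 U) :
    ∃ C, Clifford1 C ∧ ∃ (s t : ℂ) (j k j' k' : Fin 4),
    (j' = 0 ∨ k' = 0) ∧
    (U * (C ⊗ₖ 1)) * (pauli1 1 ⊗ₖ 1) * star (U * (C ⊗ₖ 1)) = s • (pauli1 j ⊗ₖ pauli1 k) ∧
    (U * (C ⊗ₖ 1)) * (pauli1 3 ⊗ₖ 1) * star (U * (C ⊗ₖ 1)) = t • (pauli1 j' ⊗ₖ pauli1 k') := by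
  have hconj : ∀ C P : Matrix (Fin 2) (Fin 2) ℂ,
      (U * (C ⊗ₖ 1)) * (P ⊗ₖ 1) * star (U * (C ⊗ₖ 1)) =
        U * ((C * P * star C) ⊗ₖ 1) * star U := fun C P => by
    rw [star_mul, star_kronecker, star_one, mul_assoc, mul_assoc, ← mul_assoc (P ⊗ₖ 1),
      ← Matrix.mul_kronecker_mul, ← mul_assoc (C ⊗ₖ 1), ← Matrix.mul_kronecker_mul]
    simp only [mul_one, mul_assoc]
  obtain ⟨s, j, k, hX⟩ := exists_conj_eq hU 1
  obtain ⟨t, j', k', hZ⟩ := exists_conj_eq hU 3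
  have hsign := pauliSign_mul_pauliSign hU hX hZ
  have hdec : ∀ j k j' k' : Fin 4, pauliSign j j' * pauliSign k k' = -1 →
      (j' = 0 ∨ k' = 0) ∨ (j = 0 ∨ k = 0) ∨ (j ^^^ j' = 0 ∨ k ^^^ k' = 0) := by
    unfold pauliSign
    decide
  rcases hdec j k j' k' hsign with h | h | h
  · refine ⟨1, Clifford1.one, s, t, j, k, j', k', h, ?_, ?_⟩
    · rw [hconj, star_one, one_mul, mul_one, hX]
    · rw [hconj, star_one, one_mul, mul_one, hZ]
  · obtain ⟨C, hC, hCX, hCZ⟩ := exists_clifford1_conj (j := 3) (k := 1) rfl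
      (Or.inl (rfl : (1 : ℂ) = 1)) (Or.inl (rfl : (1 : ℂ) = 1))
    refine ⟨C, hC, t, s, j', k', j, k, h, ?_, ?_⟩
    · rw [hconj, hCX, one_smul, hZ]
    · rw [hconj, hCZ, one_smul, hX]
  · obtain ⟨C, hC, hCX, hCZ⟩ := exists_clifford1_conj (j := 1) (k := 2) rfl
      (Or.inl (rfl : (1 : ℂ) = 1)) (Or.inl (rfl : (1 : ℂ) = 1))
    refine ⟨C, hC, s, Complex.I * (s * t * (pauliPhase j j' * pauliPhase k k')), j, k,
      j ^^^ j', k ^^^ k', h, ?_, ?_⟩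
    · rw [hconj, hCX, one_smul, hX]
    · have hY : pauli1 2 ⊗ₖ (1 : Matrix (Fin 2) (Fin 2) ℂ) =
          Complex.I • ((pauli1 1 ⊗ₖ 1) * (pauli1 3 ⊗ₖ 1)) := by
        rw [← Matrix.mul_kronecker_mul, pauli1_mul, mul_one, Matrix.smul_kronecker, smul_smul]
        simp [pauliPhase]
      rw [hconj, hCZ, one_smul, hY, Matrix.mul_smul, Matrix.smul_mul, ← hU.conj_mul_conj, hX, hZ,
        Matrix.smul_mul, Matrix.mul_smul, ← Matrix.mul_kronecker_mul, pauli1_mul, pauli1_mul,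
        Matrix.smul_kronecker, Matrix.kronecker_smul]
      simp only [smul_smul, mul_assoc]

end Image

theorem clifford1_of_one_kronecker {D : Matrix (Fin 2) (Fin 2) ℂ} (h : Clifford2 (1 ⊗ₖ D)) :
    Clifford1 D := by
  have hDD : D * star D = 1 := by
    have h1 := h.mul_star_self
    rw [star_kronecker, ← Matrix.mul_kronecker_mul] at h1
    ext i j
    simpa [Matrix.one_apply] using congrFun (congrFun h1 (0, i)) (0, j)
  refine ⟨Matrix.mem_unitaryGroup_iff.2 hDD, fun P hP => ?_⟩
  obtain ⟨c, hc, j, k, hjk⟩ := h.2 _ (kronecker_mem_Pauli2Group (pauli1_mem_Pauli1Group 0) hP)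
  rw [star_kronecker, ← Matrix.mul_kronecker_mul, ← Matrix.mul_kronecker_mul, pauli1_zero, star_one,
    one_mul, one_mul] at hjk
  have key : D * P * star D = (c * pauli1 j 0 0) • pauli1 k := by
    ext a b
    simpa [mul_assoc] using congrFun (congrFun hjk (0, a)) (0, b)
  have hne : D * P * star D ≠ 0 := fun h0 => by
    have hP0 : P = 0 := by
      have h2 := congrArg (fun M => star D * M * D) h0
      simpa [mul_assoc, mul_eq_one_comm.1 hDD, ← mul_assoc (star D) D] using h2
    obtain ⟨d, hd, l, rfl⟩ := hP
    have hd0 : d ≠ 0 := by rcases hd with rfl | rfl | rfl | rfl <;> simp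
    have h3 : pauli1 l = 0 := (smul_eq_zero.1 hP0).resolve_left hd0
    have h4 := pauli1_mul_self l
    rw [h3, zero_mul] at h4
    exact zero_ne_one h4
  have hj : pauli1 j 0 0 = 0 ∨ pauli1 j 0 0 = 1 := by
    fin_cases j <;> simp [pauli1]
  rcases hj with hj | hj
  · rw [hj, mul_zero, zero_smul] at key
    exact absurd key hne
  · rw [key, hj, mul_one]
    exact ⟨c, hc, k, rfl⟩

theorem ite_CZgate_mul_self (a : Bool) :
    (if a then CZgate else 1) * (if a then CZgate else 1) = 1 := by
  cases a <;> simp [CZgate_mul_self]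

theorem ite_CZgate_mul_X (a : Bool) :
    (if a then CZgate else 1) * (pauli1 1 ⊗ₖ pauli1 (if a then 3 else 0)) =
      (pauli1 1 ⊗ₖ 1) * (if a then CZgate else 1) := by
  cases a
  · simp [pauli1_zero]
  · have h := CZgate_mul_pauli1_kronecker_one 1
    simp only [true_or, if_true] at h ⊢
    calc _ = CZgate * ((pauli1 1 ⊗ₖ pauli1 3) * CZgate) * CZgate := by
          rw [mul_assoc, mul_assoc, CZgate_mul_self, mul_one]
      _ = _ := by rw [← h, ← mul_assoc, CZgate_mul_self, one_mul]

theorem ite_CZgate_mul_Z (a : Bool) :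
    (if a then CZgate else 1) * (pauli1 3 ⊗ₖ 1) = (pauli1 3 ⊗ₖ 1) * (if a then CZgate else 1) := by
  cases a
  · simp
  · exact CZgate_mul_pauli1_kronecker_one 3

theorem exists_clifford1_conj_ite (k : Fin 4) : ∃ (B : Matrix (Fin 2) (Fin 2) ℂ) (a : Bool),
    Clifford1 B ∧ B * pauli1 (if a then 3 else 0) * star B = pauli1 k := by
  by_cases hk : k = 0
  · exact ⟨1, false, Clifford1.one, by simp [hk]⟩
  · obtain ⟨j, hj⟩ : ∃ j, pauliSign j k = -1 := by
      revert k
      unfold pauliSign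
      decide
    obtain ⟨B, hB, -, h⟩ := exists_clifford1_conj hj (Or.inl (rfl : (1 : ℂ) = 1))
      (Or.inl (rfl : (1 : ℂ) = 1))
    exact ⟨B, true, hB, by simpa using h⟩

theorem exists_kak_of_conj_eq {U : Matrix (Fin 2 × Fin 2) (Fin 2 × Fin 2) ℂ} (hU : Clifford2 U)
    {s t : ℂ} {j k j' : Fin 4} (hX : U * (pauli1 1 ⊗ₖ 1) * star U = s • (pauli1 j ⊗ₖ pauli1 k))
    (hZ : U * (pauli1 3 ⊗ₖ 1) * star U = t • (pauli1 j' ⊗ₖ pauli1 0)) :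
    ∃ (a : Bool) (A B D : Matrix (Fin 2) (Fin 2) ℂ), Clifford1 A ∧ Clifford1 B ∧ Clifford1 D ∧
      U = (A ⊗ₖ B) * (if a then CZgate else 1) * (1 ⊗ₖ D) := by
  have hsign := pauliSign_mul_pauliSign hU hX hZ
  have hk0 : pauliSign k 0 = 1 := by simp [pauliSign]
  rw [hk0, mul_one] at hsign
  obtain ⟨A, hA, hAX, hAZ⟩ := exists_clifford1_conj hsign (eq_one_or_neg_one_of_conj_eq hU hX)
    (eq_one_or_neg_one_of_conj_eq hU hZ)
  obtain ⟨B, a, hB, hBa⟩ := exists_clifford1_conj_ite k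
  have hL := Clifford2.kronecker hA hB
  have hL' := Clifford2.kronecker hA.star hB.star
  rw [← star_kronecker] at hL'
  have hK := Clifford2.ite_cz a
  have hKK := ite_CZgate_mul_self a
  have hKX := ite_CZgate_mul_X a
  have hKZ := ite_CZgate_mul_Z a
  have hLX : U * (pauli1 1 ⊗ₖ 1) * star U =
      (A ⊗ₖ B) * (pauli1 1 ⊗ₖ pauli1 (if a then 3 else 0)) * star (A ⊗ₖ B) := by
    rw [star_kronecker, ← Matrix.mul_kronecker_mul, ← Matrix.mul_kronecker_mul, hAX, hBa, hX,
      Matrix.smul_kronecker]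
  have hLZ : U * (pauli1 3 ⊗ₖ 1) * star U =
      (A ⊗ₖ B) * (pauli1 3 ⊗ₖ 1) * star (A ⊗ₖ B) := by
    rw [star_kronecker, ← Matrix.mul_kronecker_mul, ← Matrix.mul_kronecker_mul, hAZ, mul_one,
      hB.mul_star_self, hZ, Matrix.smul_kronecker, pauli1_zero]
  generalize hKe : (if a then CZgate else 1 : Matrix (Fin 2 × Fin 2) (Fin 2 × Fin 2) ℂ) = K at *
  generalize hLe : A ⊗ₖ B = L at *
  have move : ∀ P Q, U * P * star U = L * Q * star L →
      K * star L * U * P = K * Q * (star L * U) := fun P Q h => by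
    calc K * star L * U * P = K * star L * (U * P * star U) * U := by
          simp only [mul_assoc, hU.star_mul_self, mul_one]
      _ = K * Q * (star L * U) := by
          rw [h]
          simp only [mul_assoc, ← mul_assoc (star L) L, hL.star_mul_self, one_mul]
  obtain ⟨D, hD⟩ := exists_eq_one_kronecker (K * star L * U)
    (by rw [move _ _ hLX, hKX]; simp only [mul_assoc])
    (by rw [move _ _ hLZ, hKZ]; simp only [mul_assoc])
  refine ⟨a, A, B, D, hA, hB, clifford1_of_one_kronecker ?_, ?_⟩
  · rw [← hD]
    exact (hK.mul hL').mul hU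
  · rw [← hD, hKe, hLe]
    calc U = L * star L * U := by rw [hL.mul_star_self, one_mul]
      _ = L * (K * K) * (star L * U) := by rw [hKK, mul_one, mul_assoc]
      _ = _ := by simp only [mul_assoc]

theorem exists_kak {U : Matrix (Fin 2 × Fin 2) (Fin 2 × Fin 2) ℂ} (hU : Clifford2 U) :
    ∃ (ab : Bool × Bool) (A B C D : Matrix (Fin 2) (Fin 2) ℂ),
      Clifford1 A ∧ Clifford1 B ∧ Clifford1 C ∧ Clifford1 D ∧
      U = (A ⊗ₖ B) * (if ab.1 then CZgate else 1) *
          (if ab.2 then SWAPgate else 1) * (C ⊗ₖ D) := by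
  obtain ⟨C, hC, s, t, j, k, j', k', h0, hX, hZ⟩ := exists_conj_eq_local hU
  have hW := hU.mul (Clifford2.kronecker hC Clifford1.one)
  have hcancel : U = U * (C ⊗ₖ 1) * (star C ⊗ₖ 1) := by
    rw [mul_assoc, ← Matrix.mul_kronecker_mul, hC.mul_star_self, mul_one, Matrix.one_kronecker_one,
      mul_one]
  have hmerge : ∀ D : Matrix (Fin 2) (Fin 2) ℂ, (1 ⊗ₖ D) * (star C ⊗ₖ 1) = star C ⊗ₖ D :=
    fun D => by rw [← Matrix.mul_kronecker_mul, one_mul, mul_one]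
  generalize U * (C ⊗ₖ 1) = W at *
  rcases h0 with rfl | rfl
  · have hconj : ∀ (P : Matrix (Fin 2) (Fin 2) ℂ) (c : ℂ) (j k : Fin 4),
        W * (P ⊗ₖ 1) * star W = c • (pauli1 j ⊗ₖ pauli1 k) →
        (SWAPgate * W) * (P ⊗ₖ 1) * star (SWAPgate * W) = c • (pauli1 k ⊗ₖ pauli1 j) :=
      fun P c j k h => by
        calc _ = SWAPgate * (W * (P ⊗ₖ 1) * star W) * SWAPgate := by
              rw [star_mul, star_SWAPgate]; simp only [mul_assoc]
          _ = _ := by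
              rw [h, Matrix.mul_smul, SWAPgate_mul_kronecker, Matrix.smul_mul, mul_assoc,
                SWAPgate_mul_self, mul_one]
    obtain ⟨a, A, B, D, hA, hB, hD, h⟩ := exists_kak_of_conj_eq (Clifford2.swap.mul hW)
      (hconj _ _ _ _ hX) (hconj _ _ _ _ hZ)
    refine ⟨(a, true), B, A, star C, D, hB, hA, hC.star, hD, ?_⟩
    have hK : SWAPgate * (if a then CZgate else 1) = (if a then CZgate else 1) * SWAPgate := by
      cases a <;> simp [SWAPgate_mul_CZgate]
    calc U = SWAPgate * (SWAPgate * W) * (star C ⊗ₖ 1) := by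
          rw [← mul_assoc, SWAPgate_mul_self, one_mul]; exact hcancel
      _ = (SWAPgate * (A ⊗ₖ B)) * (if a then CZgate else 1) * ((1 ⊗ₖ D) * (star C ⊗ₖ 1)) := by
          rw [h]; simp only [mul_assoc]
      _ = (B ⊗ₖ A) * (SWAPgate * (if a then CZgate else 1)) * (star C ⊗ₖ D) := by
          rw [SWAPgate_mul_kronecker, hmerge]; simp only [mul_assoc]
      _ = _ := by rw [hK]; simp only [mul_assoc, if_true]
  · obtain ⟨a, A, B, D, hA, hB, hD, h⟩ := exists_kak_of_conj_eq hW hX hZ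
    refine ⟨(a, false), A, B, star C, D, hA, hB, hC.star, hD, ?_⟩
    rw [hcancel, h, mul_assoc, hmerge]
    simp

theorem CZgate_ne_kronecker (E F : Matrix (Fin 2) (Fin 2) ℂ) : CZgate ≠ E ⊗ₖ F := fun h => by
  have h00 := congrFun (congrFun h (0, 0)) (0, 0)
  have h01 := congrFun (congrFun h (0, 1)) (0, 1)
  have h10 := congrFun (congrFun h (1, 0)) (1, 0)
  have h11 := congrFun (congrFun h (1, 1)) (1, 1)
  simp [CZgate] at h00 h01 h10 h11
  have : (-1 : ℂ) = 1 := by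
    calc (-1 : ℂ) = (E 0 0 * F 0 0) * (E 1 1 * F 1 1) := by rw [← h00, ← h11, one_mul]
      _ = (E 0 0 * F 1 1) * (E 1 1 * F 0 0) := by ring
      _ = 1 := by rw [← h01, ← h10, one_mul]
  norm_num at this

/-- The `CZ` exponent is an invariant of local equivalence. -/
theorem eq_of_ite_CZgate_eq {a a' : Bool} {A B C D : Matrix (Fin 2) (Fin 2) ℂ}
    (hA : Clifford1 A) (hB : Clifford1 B) (hC : Clifford1 C) (hD : Clifford1 D)
    (h : (if a' then CZgate else 1) = (A ⊗ₖ B) * (if a then CZgate else 1) * (C ⊗ₖ D)) :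
    a' = a := by
  cases a <;> cases a' <;> simp only [Bool.false_eq_true, if_false, if_true, mul_one] at h ⊢
  · rw [← Matrix.mul_kronecker_mul] at h
    exact absurd h (CZgate_ne_kronecker _ _)
  · have h1 := congrArg (fun M => (star A ⊗ₖ star B) * M * (star C ⊗ₖ star D)) h
    refine absurd ?_ (CZgate_ne_kronecker (star A * star C) (star B * star D))
    have hl : (star A ⊗ₖ star B) * (A ⊗ₖ B) = 1 := by
      rw [← Matrix.mul_kronecker_mul, hA.star_mul_self, hB.star_mul_self, Matrix.one_kronecker_one]
    have hr : (C ⊗ₖ D) * (star C ⊗ₖ star D) = 1 := by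
      rw [← Matrix.mul_kronecker_mul, hC.mul_star_self, hD.mul_star_self, Matrix.one_kronecker_one]
    rw [mul_one, ← Matrix.mul_kronecker_mul] at h1
    rw [h1]
    simp only [mul_assoc, hr, mul_one]
    rw [← mul_assoc, hl, one_mul]

theorem ite_CZgate_mul_one_kronecker_ne (a : Bool) {P Q : Matrix (Fin 2) (Fin 2) ℂ}
    (hP : P.trace = 0) (hP0 : P ≠ 0) :
    (if a then CZgate else 1) * (1 ⊗ₖ P) ≠ (Q ⊗ₖ 1) * (if a then CZgate else 1) := fun h => by
  have e : ∀ i j, P i j = Q 0 0 * (1 : Matrix (Fin 2) (Fin 2) ℂ) i j := fun i j => by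
    have := congrFun (congrFun h (0, i)) (0, j)
    cases a <;> fin_cases i <;> fin_cases j <;>
      simpa [CZgate, Matrix.mul_apply, Fintype.sum_prod_type, Matrix.one_apply] using this
  have hPQ : P = Q 0 0 • 1 := by
    ext i j
    exact e i j
  have hQ : Q 0 0 = 0 := by simpa [hPQ] using hP
  exact hP0 (by rw [hPQ, hQ, zero_smul])

/-- The `SWAP` exponent is an invariant of local equivalence. -/
theorem ite_CZgate_mul_SWAPgate_ne (a a' : Bool) {A B C D : Matrix (Fin 2) (Fin 2) ℂ}
    (hA : Clifford1 A) (hC : Clifford1 C) :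
    (if a' then CZgate else 1) * SWAPgate ≠ (A ⊗ₖ B) * (if a then CZgate else 1) * (C ⊗ₖ D) :=
  fun h => by
  have hP : star C * pauli1 3 * C * (star C * pauli1 3 * C) = 1 := by
    simp only [mul_assoc, ← mul_assoc C (star C), hC.mul_star_self, one_mul]
    rw [← mul_assoc (pauli1 3), pauli1_mul_self, one_mul, hC.star_mul_self]
  have hP0 : star C * pauli1 3 * C ≠ 0 := fun h0 => by
    rw [h0, zero_mul] at hP
    exact zero_ne_one hP
  have htr : (star C * pauli1 3 * C).trace = 0 := by
    rw [Matrix.trace_mul_comm, ← mul_assoc, hC.mul_star_self, one_mul]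
    simp [pauli1, Matrix.trace]
  refine ite_CZgate_mul_one_kronecker_ne a' (Q := A * pauli1 3 * star A) htr hP0 ?_
  have hCP : (C ⊗ₖ D) * ((star C * pauli1 3 * C) ⊗ₖ 1) = (pauli1 3 ⊗ₖ 1) * (C ⊗ₖ D) := by
    rw [← Matrix.mul_kronecker_mul, ← Matrix.mul_kronecker_mul, mul_one, one_mul, ← mul_assoc,
      ← mul_assoc, hC.mul_star_self, one_mul]
  have hAQ : (A ⊗ₖ B) * (pauli1 3 ⊗ₖ 1) = ((A * pauli1 3 * star A) ⊗ₖ 1) * (A ⊗ₖ B) := by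
    rw [← Matrix.mul_kronecker_mul, ← Matrix.mul_kronecker_mul, mul_one, one_mul, mul_assoc,
      hA.star_mul_self, mul_one]
  have hZ := ite_CZgate_mul_Z a
  have key : (if a' then CZgate else 1) * SWAPgate * ((star C * pauli1 3 * C) ⊗ₖ 1) =
      ((A * pauli1 3 * star A) ⊗ₖ 1) * ((if a' then CZgate else 1) * SWAPgate) := by
    rw [h]
    generalize (if a then CZgate else 1 : Matrix (Fin 2 × Fin 2) (Fin 2 × Fin 2) ℂ) = K at hZ ⊢
    rw [mul_assoc, hCP, ← mul_assoc, mul_assoc (A ⊗ₖ B), hZ, ← mul_assoc, hAQ]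
    simp only [mul_assoc]
  have key' := congrArg (fun M => M * SWAPgate) key
  simpa only [mul_assoc, SWAPgate_mul_kronecker, SWAPgate_mul_self, mul_one] using key'

theorem kak_unique {ab ab' : Bool × Bool} {A B C D : Matrix (Fin 2) (Fin 2) ℂ}
    (hA : Clifford1 A) (hB : Clifford1 B) (hC : Clifford1 C) (hD : Clifford1 D)
    (h : (if ab'.1 then CZgate else 1) * (if ab'.2 then SWAPgate else 1) =
      (A ⊗ₖ B) * (if ab.1 then CZgate else 1) * (if ab.2 then SWAPgate else 1) * (C ⊗ₖ D)) :
    ab' = ab := by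
  obtain ⟨a, b⟩ := ab
  obtain ⟨a', b'⟩ := ab'
  cases b <;> cases b' <;> simp only [Bool.false_eq_true, if_false, if_true, mul_one] at h
  · rw [eq_of_ite_CZgate_eq hA hB hC hD h]
  · exact absurd h (ite_CZgate_mul_SWAPgate_ne a a' hA hC)
  · rw [mul_assoc, SWAPgate_mul_kronecker, ← mul_assoc] at h
    have h1 := congrArg (fun M => M * SWAPgate) h
    simp only [mul_assoc _ SWAPgate, SWAPgate_mul_self, mul_one] at h1
    exact absurd h1 (ite_CZgate_mul_SWAPgate_ne a a' hA hD)
  · rw [mul_assoc, SWAPgate_mul_kronecker, ← mul_assoc] at h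
    have h1 := congrArg (fun M => M * SWAPgate) h
    simp only [mul_assoc _ SWAPgate, SWAPgate_mul_self, mul_one] at h1
    rw [eq_of_ite_CZgate_eq hA hB hD hC h1]

/-- Every two-qubit Clifford unitary `U` decomposes as
`U = (A ⊗ B) · CZ^a · SWAP^b · (C ⊗ D)` with `A, B, C, D` single-qubit
Cliffords and bits `a, b`; the pair `(a, b)` is uniquely determined by `U`,
yielding exactly four KAK-equivalence classes. -/
theorem clifford2_kak (U : Matrix (Fin 2 × Fin 2) (Fin 2 × Fin 2) ℂ)
    (hU : Clifford2 U) :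
    ∃! ab : Bool × Bool, ∃ A B C D : Matrix (Fin 2) (Fin 2) ℂ,
      Clifford1 A ∧ Clifford1 B ∧ Clifford1 C ∧ Clifford1 D ∧
      U = (A ⊗ₖ B) * (if ab.1 then CZgate else 1) *
          (if ab.2 then SWAPgate else 1) * (C ⊗ₖ D) := by
  obtain ⟨ab, A, B, C, D, hA, hB, hC, hD, h⟩ := exists_kak hU
  refine ⟨ab, ⟨A, B, C, D, hA, hB, hC, hD, h⟩, ?_⟩
  rintro ab' ⟨A', B', C', D', hA', hB', hC', hD', h'⟩
  have hl : (star A' ⊗ₖ star B') * (A' ⊗ₖ B') = 1 := by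
    rw [← Matrix.mul_kronecker_mul, hA'.star_mul_self, hB'.star_mul_self, Matrix.one_kronecker_one]
  have hr : (C' ⊗ₖ D') * (star C' ⊗ₖ star D') = 1 := by
    rw [← Matrix.mul_kronecker_mul, hC'.mul_star_self, hD'.mul_star_self, Matrix.one_kronecker_one]
  refine kak_unique (hA'.star.mul hA) (hB'.star.mul hB) (hC.mul hC'.star) (hD.mul hD'.star) ?_
  calc _ = (star A' ⊗ₖ star B') * U * (star C' ⊗ₖ star D') := by
        rw [h']
        simp only [mul_assoc, hr, mul_one]
        rw [← mul_assoc, hl, one_mul]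
    _ = _ := by
        rw [h, Matrix.mul_kronecker_mul, Matrix.mul_kronecker_mul]
        simp only [mul_assoc]
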